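/- Let p, q be real numbers with 0 ≤ p < q ≤ 1, let I ⊆ (0,1) be an interval forecast contained in the open unit interval, let 𝒮 be a countable set of selection processes with 𝒮 ⊇ 𝒮^{p,q}_{𝓕_ML}, and let ϖ ∈ Ω be a path that is 𝒮-random for the stationary forecasting system I. Then a path ω ∈ Ω is ML-random for the temporal precise forecasting system φ^ϖ_{p,q} if and only if ω is ML-random for the stationary interval forecast [p,q]. -/

import Mathlib

open Filter Classical

/-- Situations: finite binary strings. -/
abbrev Situation := List Bool

/-- Paths: infinite binary sequences. -/
abbrev BinPath := ℕ → Bool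

/-- The length-`n` prefix `ω_{1:n}` of a path. -/
def pref (ω : BinPath) (n : ℕ) : Situation := List.ofFn (fun i : Fin n => ω i)

/-- The real value of a bit. -/
def bit (x : Bool) : ℝ := if x then 1 else 0

/-- Local expectation `E_p(f) = p f(1) + (1-p) f(0)` of a gamble `f : Bool → ℝ`. -/
def localE (p : ℝ) (f : Bool → ℝ) : ℝ := p * f true + (1 - p) * f false

/-- Upper expectation of a gamble for interval forecast `[lo, hi]`. -/
def upperE (lo hi : ℝ) (f : Bool → ℝ) : ℝ := max (localE lo f) (localE hi f)

/-- A forecasting system, given by lower and upper bounds `lo hi : Situation → ℝ`,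
is proper when `0 ≤ lo s ≤ hi s ≤ 1` everywhere. -/
def IsForecastingSystem (lo hi : Situation → ℝ) : Prop :=
  ∀ s, 0 ≤ lo s ∧ lo s ≤ hi s ∧ hi s ≤ 1

/-- The process difference `ΔF(s) : x ↦ F(s·x) − F(s)`. -/
def diffP (F : Situation → ℝ) (s : Situation) : Bool → ℝ := fun x => F (s ++ [x]) - F s

/-- A supermartingale for the forecasting system `(lo, hi)`. -/
def IsSupermartingale (lo hi : Situation → ℝ) (F : Situation → ℝ) : Prop :=
  ∀ s, upperE (lo s) (hi s) (diffP F s) ≤ 0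

/-- A test supermartingale: a nonnegative supermartingale starting at 1. -/
def IsTestSupermartingale (lo hi : Situation → ℝ) (F : Situation → ℝ) : Prop :=
  IsSupermartingale lo hi F ∧ (∀ s, 0 ≤ F s) ∧ F [] = 1

/-- A real process is (positive) rational-valued and recursive. -/
def IsRecursiveRational (F : Situation → ℝ) : Prop :=
  ∃ q : Situation → ℚ, Computable q ∧ ∀ s, (q s : ℝ) = F s

/-- A real process is computable. -/
def IsComputableProcess (F : Situation → ℝ) : Prop :=
  ∃ q : Situation → ℕ → ℚ, Computable₂ q ∧
    ∀ s n, |F s - q s n| < (2 : ℝ) ^ (-(n : ℤ))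

/-- A real process is lower semicomputable. -/
def IsLSCProcess (F : Situation → ℝ) : Prop :=
  ∃ q : Situation → ℕ → ℚ, Computable₂ q ∧
    (∀ s n, q s n ≤ q s (n + 1)) ∧
    ∀ s, Tendsto (fun m => (q s m : ℝ)) atTop (nhds (F s))

/-- A (real) growth function: computable, nonnegative, nondecreasing and unbounded. -/
def IsGrowthFunction (τ : ℕ → ℝ) : Prop :=
  (∀ n, 0 ≤ τ n) ∧ (∀ n, τ n ≤ τ (n + 1)) ∧ Tendsto τ atTop atTop ∧
    ∃ q : ℕ → ℕ → ℚ, Computable₂ q ∧ ∀ n m, |τ n - q n m| < (2 : ℝ) ^ (-(m : ℤ))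

/-- A real process is unbounded on a path: `limsup_n T(ω_{1:n}) = ∞`. -/
def UnboundedOn (T : Situation → ℝ) (ω : BinPath) : Prop :=
  limsup (fun n => ((T (pref ω n) : ℝ) : EReal)) atTop = ⊤

/-- A real process is computably unbounded on a path:
`limsup_n [T(ω_{1:n}) − τ(n)] ≥ 0` for some growth function `τ`. -/
def ComputablyUnboundedOn (T : Situation → ℝ) (ω : BinPath) : Prop :=
  ∃ τ : ℕ → ℝ, IsGrowthFunction τ ∧
    0 ≤ limsup (fun n => ((T (pref ω n) - τ n : ℝ) : EReal)) atTop

/-- Computable randomness for the forecasting system `(lo, hi)`: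
no recursive positive rational test supermartingale is unbounded on `ω`. -/
def CRandom (lo hi : Situation → ℝ) (ω : BinPath) : Prop :=
  ∀ T : Situation → ℝ, IsRecursiveRational T → (∀ s, 0 < T s) →
    IsTestSupermartingale lo hi T → ¬ UnboundedOn T ω

/-- Schnorr randomness for the forecasting system `(lo, hi)`:
no recursive positive rational test supermartingale is computably unbounded on `ω`. -/
def SchnorrRandom (lo hi : Situation → ℝ) (ω : BinPath) : Prop :=
  ∀ T : Situation → ℝ, IsRecursiveRational T → (∀ s, 0 < T s) →
    IsTestSupermartingale lo hi T → ¬ ComputablyUnboundedOn T ω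

/-- Martin-Löf randomness for the forecasting system `(lo, hi)`:
no lower semicomputable test supermartingale is unbounded on `ω`. -/
def MLRandom (lo hi : Situation → ℝ) (ω : BinPath) : Prop :=
  ∀ T : Situation → ℝ, IsLSCProcess T →
    IsTestSupermartingale lo hi T → ¬ UnboundedOn T ω

/-- A selection process is temporal if its value depends only on the length. -/
def IsTemporal (S : Situation → Bool) : Prop :=
  ∀ s t : Situation, s.length = t.length → S s = S t

/-- Value of a selection process along a path. -/
def selVal (S : Situation → Bool) (ω : BinPath) (k : ℕ) : ℝ := if S (pref ω k) then 1 else 0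

/-- `ω` is `𝒮`-random for the forecasting system `(lo, hi)`. -/
def SSetRandom (𝒮 : Set (Situation → Bool)) (lo hi : Situation → ℝ) (ω : BinPath) : Prop :=
  ∀ S ∈ 𝒮,
    Tendsto (fun n => ∑ k ∈ Finset.range n, selVal S ω k) atTop atTop →
      0 ≤ liminf (fun n =>
          (((∑ k ∈ Finset.range n, selVal S ω k * (bit (ω k) - lo (pref ω k))) /
              (∑ k ∈ Finset.range n, selVal S ω k) : ℝ) : EReal)) atTop ∧
        limsup (fun n =>
          (((∑ k ∈ Finset.range n, selVal S ω k * (bit (ω k) - hi (pref ω k))) /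
              (∑ k ∈ Finset.range n, selVal S ω k) : ℝ) : EReal)) atTop ≤ 0

/-- Weak Church randomness: the selection-process conditions hold for all
recursive temporal selection processes. -/
def WCHRandom (lo hi : Situation → ℝ) (ω : BinPath) : Prop :=
  SSetRandom {S | Computable S ∧ IsTemporal S} lo hi ω

/-- Global upper expectation of a bounded global gamble `f : BinPath → ℝ`. -/
noncomputable def globalUpperE (lo hi : Situation → ℝ) (f : BinPath → ℝ) : ℝ :=
  sInf {m : ℝ | ∃ M : Situation → ℝ, IsSupermartingale lo hi M ∧ M [] = m ∧
    ∀ ω : BinPath, (f ω : EReal) ≤ liminf (fun n => ((M (pref ω n) : ℝ) : EReal)) atTop}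

/-- Upper probability of an event. -/
noncomputable def upperProb (lo hi : Situation → ℝ) (A : Set BinPath) : ℝ :=
  globalUpperE lo hi (Set.indicator A 1)

/-- An event is almost sure if its complement has upper probability zero. -/
def AlmostSure (lo hi : Situation → ℝ) (A : Set BinPath) : Prop :=
  upperProb lo hi Aᶜ = 0

/-- The set of recursive positive rational test processes `𝓕_C`. -/
def FsetC : Set (Situation → ℝ) :=
  {F | IsRecursiveRational F ∧ (∀ s, 0 < F s) ∧ F [] = 1}

/-- The set of lower semicomputable test processes `𝓕_ML`. -/
def FsetML : Set (Situation → ℝ) :=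
  {F | IsLSCProcess F ∧ (∀ s, 0 ≤ F s) ∧ F [] = 1}

/-- The temporal selection process `S^r_F` associated with a real process `F`
and a number `r`. -/
noncomputable def selProc (r : ℝ) (F : Situation → ℝ) : Situation → Bool := fun s =>
  if ∃ t : Situation, t.length = s.length ∧ 0 < localE r (diffP F t) then true else false

/-- The set of selection processes `𝒮^{p,q}_𝓕`. -/
def SelSet (p q : ℝ) (𝓕 : Set (Situation → ℝ)) : Set (Situation → Bool) :=
  {S | ∃ F ∈ 𝓕, ∃ r ∈ ({p, q} : Set ℝ), S = selProc r F}

/-- The temporal precise forecasting system `φ^ϖ_{p,q}`. -/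
def tempFS (p q : ℝ) (ϖ : BinPath) : Situation → ℝ := fun s => if ϖ s.length then q else p

/-- A test process `F` is generated by the multiplier process `D`. -/
def GeneratedBy (D : Situation → Bool → ℝ) (F : Situation → ℝ) : Prop :=
  F [] = 1 ∧ ∀ s x, F (s ++ [x]) = F s * D s x

/-- A lower semicomputable multiplier process: a nonnegative gamble process that
is lower semicomputable. -/
def IsLSCMultiplier (D : Situation → Bool → ℝ) : Prop :=
  (∀ s x, 0 ≤ D s x) ∧
  ∃ q : Situation → Bool → ℕ → ℚ,
    Computable (fun p : Situation × Bool × ℕ => q p.1 p.2.1 p.2.2) ∧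
    (∀ s x n, q s x n ≤ q s x (n + 1)) ∧
    ∀ s x, Tendsto (fun m => (q s x m : ℝ)) atTop (nhds (D s x))

/-- Raw numerical code of a rational. -/
def rawCode (x : ℚ) : ℕ := Nat.pair (Equiv.intEquivNat x.num) x.den

lemma rawCode_eq (x : ℚ) : rawCode x = @Encodable.encode ℚ Rat.instEncodable x := by
  cases x; rfl

/-- Membership test for the raw codes. -/
def GoodCode (m : ℕ) : Prop :=
  0 < m.unpair.2 ∧ ∀ k < m.unpair.2 + 1,
    ¬ ((m.unpair.1 + 1) / 2 % k = 0 ∧ m.unpair.2 % k = 0 ∧ ¬ k = 1)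

lemma natAbs_code (a : ℤ) : (Equiv.intEquivNat a + 1) / 2 = a.natAbs := by
  cases a with
  | ofNat n =>
    have : Equiv.intEquivNat (Int.ofNat n) = 2 * n := rfl
    rw [this]; simp; omega
  | negSucc n =>
    have : Equiv.intEquivNat (Int.negSucc n) = 2 * n + 1 := rfl
    rw [this]; simp; omega

lemma bodd_code (a : ℤ) : (Equiv.intEquivNat a).bodd = decide (a < 0) := by
  cases a with
  | ofNat n =>
    have : Equiv.intEquivNat (Int.ofNat n) = 2 * n := rfl
    rw [this]; simp
  | negSucc n =>
    have : Equiv.intEquivNat (Int.negSucc n) = 2 * n + 1 := rfl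
    rw [this]; simp [Int.negSucc_lt_zero]

lemma goodCode_iff (m : ℕ) : GoodCode m ↔ m ∈ Set.range rawCode := by
  constructor
  · rintro ⟨h0, h1⟩
    obtain ⟨a, ha⟩ := Equiv.intEquivNat.surjective m.unpair.1
    rw [← ha] at h1
    simp only [natAbs_code] at h1
    refine ⟨⟨a, m.unpair.2, h0.ne', ?_⟩, ?_⟩
    · by_contra hc
      refine h1 (Nat.gcd a.natAbs m.unpair.2) ?_ ⟨?_, ?_, hc⟩
      · exact Nat.lt_succ_of_le (Nat.le_of_dvd h0 (Nat.gcd_dvd_right _ _))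
      · exact Nat.mod_eq_zero_of_dvd (Nat.gcd_dvd_left _ _)
      · exact Nat.mod_eq_zero_of_dvd (Nat.gcd_dvd_right _ _)
    · simp only [rawCode]
      rw [ha, Nat.pair_unpair]
  · rintro ⟨x, rfl⟩
    simp only [GoodCode, rawCode, Nat.unpair_pair, natAbs_code]
    refine ⟨x.den_pos, ?_⟩
    rintro k - ⟨h1, h2, h3⟩
    apply h3
    have := Nat.dvd_gcd (Nat.dvd_of_mod_eq_zero h1) (Nat.dvd_of_mod_eq_zero h2)
    rw [x.reduced] at this
    exact Nat.dvd_one.mp this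

lemma goodCode_primrec : PrimrecPred GoodCode := by
  have h2 : PrimrecRel (fun (k m : ℕ) =>
      ¬ ((m.unpair.1 + 1) / 2 % k = 0 ∧ m.unpair.2 % k = 0 ∧ ¬ k = 1)) := by
    have hu1 : Primrec (fun z : ℕ × ℕ => z.2.unpair.1) :=
      Primrec.fst.comp (Primrec.unpair.comp Primrec.snd)
    have hu2 : Primrec (fun z : ℕ × ℕ => z.2.unpair.2) :=
      Primrec.snd.comp (Primrec.unpair.comp Primrec.snd)
    have e1 : Primrec (fun z : ℕ × ℕ => (z.2.unpair.1 + 1) / 2 % z.1) :=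
      Primrec.nat_mod.comp (Primrec.nat_div.comp (Primrec.succ.comp hu1) (Primrec.const 2))
        Primrec.fst
    have e2 : Primrec (fun z : ℕ × ℕ => z.2.unpair.2 % z.1) :=
      Primrec.nat_mod.comp hu2 Primrec.fst
    have p1 : PrimrecPred (fun z : ℕ × ℕ => (z.2.unpair.1 + 1) / 2 % z.1 = 0) :=
      Primrec.eq.comp e1 (Primrec.const 0)
    have p2 : PrimrecPred (fun z : ℕ × ℕ => z.2.unpair.2 % z.1 = 0) :=
      Primrec.eq.comp e2 (Primrec.const 0)
    have p3 : PrimrecPred (fun z : ℕ × ℕ => z.1 = 1) :=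
      Primrec.eq.comp Primrec.fst (Primrec.const 1)
    exact (p1.and (p2.and p3.not)).not
  have h3 := h2.forall_lt
  have hu2 : Primrec (fun z : ℕ => z.unpair.2) := Primrec.snd.comp Primrec.unpair
  have h4 : PrimrecPred (fun m : ℕ => ∀ k < m.unpair.2 + 1,
    ¬ ((m.unpair.1 + 1) / 2 % k = 0 ∧ m.unpair.2 % k = 0 ∧ ¬ k = 1)) :=
    h3.comp (Primrec.succ.comp hu2) Primrec.id
  have h5 : PrimrecPred (fun m : ℕ => 0 < m.unpair.2) :=
    Primrec.nat_lt.comp (Primrec.const 0) hu2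
  exact h5.and h4

/-- Raw code of the `n`-th rational. -/
def rawSeq (n : ℕ) : ℕ := rawCode (Denumerable.ofNat ℚ n)

lemma rawSeq_succ (n : ℕ) :
    rawSeq n < rawSeq (n + 1) ∧ GoodCode (rawSeq (n + 1)) ∧
      ∀ m, GoodCode m → rawSeq n < m → rawSeq (n + 1) ≤ m := by
  let e0 : Encodable ℚ := Rat.instEncodable
  let d0 := @Encodable.decidableRangeEncode ℚ e0
  let _ : Infinite (Set.range (@Encodable.encode ℚ e0)) :=
    Infinite.of_injective _ (Equiv.ofInjective _ (@Encodable.encode_injective ℚ e0)).injective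
  have key : ∀ n, rawSeq n = (Nat.Subtype.ofNat (Set.range (@Encodable.encode ℚ e0)) n).1 := by
    intro n
    have h1 : Denumerable.ofNat ℚ n = (@Encodable.equivRangeEncode ℚ e0).symm
        (Nat.Subtype.ofNat (Set.range (@Encodable.encode ℚ e0)) n) := by
      have := @Denumerable.ofEquiv_ofNat _ _
        (Nat.Subtype.denumerable (Set.range (@Encodable.encode ℚ e0)))
        (@Encodable.equivRangeEncode ℚ e0) n
      exact this
    rw [rawSeq, rawCode_eq, h1]
    have h2 := (@Encodable.equivRangeEncode ℚ e0).apply_symm_apply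
      (Nat.Subtype.ofNat (Set.range (@Encodable.encode ℚ e0)) n)
    exact congrArg Subtype.val h2
  have hs : Nat.Subtype.ofNat (Set.range (@Encodable.encode ℚ e0)) (n + 1) =
    Nat.Subtype.succ (Nat.Subtype.ofNat (Set.range (@Encodable.encode ℚ e0)) n) := rfl
  refine ⟨?_, ?_, ?_⟩
  · rw [key, key, hs]
    exact Nat.Subtype.lt_succ_self _
  · rw [goodCode_iff]; exact ⟨_, rfl⟩
  · intro m hm hlt
    rw [goodCode_iff] at hm
    have hm' : m ∈ Set.range (@Encodable.encode ℚ e0) := by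
      obtain ⟨x, rfl⟩ := hm
      exact ⟨x, (rawCode_eq x).symm⟩
    rw [key] at hlt
    rw [key, hs]
    exact Nat.Subtype.succ_le_of_lt (x := ⟨m, hm'⟩) hlt

lemma rawSeq_computable : Computable rawSeq := by
  classical
  have hrel : PrimrecRel (fun (x m : ℕ) => x < m ∧ GoodCode m) :=
    (Primrec.nat_lt.comp Primrec.fst Primrec.snd).and (goodCode_primrec.comp Primrec.snd)
  have hb : Computable₂ (fun (x m : ℕ) => decide (x < m ∧ GoodCode m)) := by
    exact (PrimrecPred.decide hrel).to_comp
  have hp : Partrec (fun x : ℕ => Nat.rfind (fun m => Part.some (decide (x < m ∧ GoodCode m)))) :=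
    Partrec.rfind hb.partrec₂
  have hr : Partrec (fun n : ℕ => (Nat.rec (Part.some (rawSeq 0))
      (fun _ IH => IH.bind fun i => Nat.rfind (fun m => Part.some (decide (i < m ∧ GoodCode m)))) n
        : Part ℕ)) := by
    refine Partrec.nat_rec (f := fun n : ℕ => n) (g := fun _ => Part.some (rawSeq 0))
      (h := fun _ z => Nat.rfind (fun m => Part.some (decide (z.2 < m ∧ GoodCode m)))) 
      Computable.id (Computable.const _).partrec ?_
    exact hp.comp (Computable.snd.comp Computable.snd)
  refine hr.of_eq_tot ?_
  intro n
  induction n with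
  | zero => simp
  | succ n ih =>
    simp only [Part.mem_bind_iff]
    refine ⟨rawSeq n, ih, ?_⟩
    obtain ⟨h1, h2, h3⟩ := rawSeq_succ n
    refine Nat.mem_rfind.mpr ⟨by simp [h1, h2], ?_⟩
    intro m hm
    simp only [Part.mem_some_iff, Bool.false_eq, decide_eq_false_iff_not]
    rintro ⟨h4, h5⟩
    exact absurd (h3 m h5 h4) (not_le.mpr hm)

lemma rawCode_computable : Computable rawCode := by
  have := rawSeq_computable.comp (Computable.encode (α := ℚ))
  refine this.of_eq ?_
  intro x
  exact congrArg rawCode (Denumerable.ofNat_encode x)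

/-- Relation on raw codes expressing `y = x / R`. -/
def DivRel (R : ℕ) (a b : ℕ) : Prop :=
  a.unpair.1.bodd = b.unpair.1.bodd ∧
  (a.unpair.1 + 1) / 2 * b.unpair.2 = (b.unpair.1 + 1) / 2 * (a.unpair.2 * R)

lemma divRel_primrec (R : ℕ) : PrimrecRel (DivRel R) := by
  have a1 : Primrec (fun z : ℕ × ℕ => z.1.unpair.1) :=
    Primrec.fst.comp (Primrec.unpair.comp Primrec.fst)
  have a2 : Primrec (fun z : ℕ × ℕ => z.1.unpair.2) :=
    Primrec.snd.comp (Primrec.unpair.comp Primrec.fst)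
  have b1 : Primrec (fun z : ℕ × ℕ => z.2.unpair.1) :=
    Primrec.fst.comp (Primrec.unpair.comp Primrec.snd)
  have b2 : Primrec (fun z : ℕ × ℕ => z.2.unpair.2) :=
    Primrec.snd.comp (Primrec.unpair.comp Primrec.snd)
  have p1 : PrimrecPred (fun z : ℕ × ℕ => z.1.unpair.1.bodd = z.2.unpair.1.bodd) :=
    Primrec.eq.comp (Primrec.nat_bodd.comp a1) (Primrec.nat_bodd.comp b1)
  have p2 : PrimrecPred (fun z : ℕ × ℕ => (z.1.unpair.1 + 1) / 2 * z.2.unpair.2 =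
      (z.2.unpair.1 + 1) / 2 * (z.1.unpair.2 * R)) :=
    Primrec.eq.comp
      (Primrec.nat_mul.comp (Primrec.nat_div.comp (Primrec.succ.comp a1) (Primrec.const 2)) b2)
      (Primrec.nat_mul.comp (Primrec.nat_div.comp (Primrec.succ.comp b1) (Primrec.const 2))
        (Primrec.nat_mul.comp a2 (Primrec.const R)))
  exact p1.and p2

lemma divRel_iff (R : ℕ) (hR : 0 < R) (x y : ℚ) :
    DivRel R (rawCode x) (rawCode y) ↔ y = x / R := by
  simp only [DivRel, rawCode, Nat.unpair_pair, natAbs_code, bodd_code, decide_eq_decide]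
  have hRq : (0 : ℚ) < R := by exact_mod_cast hR
  have hx : (0 : ℚ) < x.den := by exact_mod_cast x.den_pos
  have hy : (0 : ℚ) < y.den := by exact_mod_cast y.den_pos
  have ex : x = x.num / x.den := (Rat.num_div_den x).symm
  have ey : y = y.num / y.den := (Rat.num_div_den y).symm
  have e : y = x / R ↔ x.num * (y.den : ℤ) = y.num * (x.den * R) := by
    conv_lhs => rw [ex, ey]
    rw [div_div, div_eq_div_iff hy.ne' (by positivity)]
    constructor
    · intro h; exact_mod_cast h.symm
    · intro h; exact_mod_cast h.symm
  rw [e]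
  constructor
  · rintro ⟨h1, h2⟩
    have h2' : (x.num.natAbs : ℤ) * y.den = y.num.natAbs * (x.den * R) := by exact_mod_cast h2
    by_cases h : x.num < 0
    · have h' := h1.mp h
      rw [Int.ofNat_natAbs_of_nonpos h.le, Int.ofNat_natAbs_of_nonpos h'.le] at h2'
      linarith
    · have h' := fun hh => h (h1.mpr hh)
      rwa [Int.natAbs_of_nonneg (not_lt.mp h), Int.natAbs_of_nonneg (not_lt.mp h')] at h2'
  · intro h
    have h3 := e.mpr h
    refine ⟨?_, ?_⟩
    · rw [Rat.num_neg, Rat.num_neg, h3, div_neg_iff]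
      constructor
      · intro h; exact Or.inr ⟨h, hRq⟩
      · rintro (⟨_, h⟩ | ⟨h, _⟩)
        · linarith
        · exact h
    · have := congrArg Int.natAbs h
      simpa [Int.natAbs_mul] using this

lemma divConst_computable (R : ℕ) (hR : 0 < R) : Computable (fun x : ℚ => x / R) := by
  classical
  have hb0 : Computable₂ (fun a b : ℕ => decide (DivRel R a b)) :=
    (PrimrecPred.decide (divRel_primrec R)).to_comp
  have hb : Computable₂ (fun (x : ℚ) (k : ℕ) => decide (DivRel R (rawCode x) (rawSeq k))) :=
    hb0.comp₂ (rawCode_computable.comp Computable.fst).to₂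
      (rawSeq_computable.comp Computable.snd).to₂
  have hp : Partrec (fun x : ℚ =>
      Nat.rfind (fun k => Part.some (decide (DivRel R (rawCode x) (rawSeq k))))) :=
    Partrec.rfind hb.partrec₂
  have : Computable (fun x : ℚ => Denumerable.eqv ℚ (x / (R : ℚ))) := by
    refine hp.of_eq_tot ?_
    intro x
    obtain ⟨K, hK⟩ : ∃ K, K = Denumerable.eqv ℚ (x / (R : ℚ)) := ⟨_, rfl⟩
    have hK1 : Denumerable.ofNat ℚ K = x / R := by
      rw [hK]; exact (Denumerable.eqv ℚ).symm_apply_apply _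
    have hK2 : ∀ m, Denumerable.ofNat ℚ m = x / R → m = K := by
      intro m hm
      rw [hK, ← hm]
      exact ((Denumerable.eqv ℚ).apply_symm_apply m).symm
    rw [← hK]
    have h3 : DivRel R (rawCode x) (rawSeq K) := (divRel_iff R hR x _).mpr hK1
    refine Nat.mem_rfind.mpr ⟨?_, ?_⟩
    · exact Part.mem_some_iff.mpr (decide_eq_true h3).symm
    · intro m hm
      refine Part.mem_some_iff.mpr (decide_eq_false ?_).symm
      intro h
      exact hm.ne (hK2 m ((divRel_iff R hR x _).mp h))
  exact Computable.encode_iff.mp this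

lemma pref_length (ω : BinPath) (n : ℕ) : (pref ω n).length = n := by simp [pref]

lemma upperE_nonpos_iff (lo hi : ℝ) (f : Bool → ℝ) :
    upperE lo hi f ≤ 0 ↔ localE lo f ≤ 0 ∧ localE hi f ≤ 0 := max_le_iff

lemma localE_nonpos_between {p q r : ℝ} (h1 : p ≤ r) (h2 : r ≤ q) {f : Bool → ℝ}
    (hp : localE p f ≤ 0) (hq : localE q f ≤ 0) : localE r f ≤ 0 := by
  unfold localE at *
  rcases le_total (f true) (f false) with h | h <;> nlinarith

lemma localE_nonpos_of {p : ℝ} (h1 : 0 ≤ p) (h2 : p ≤ 1) {f : Bool → ℝ}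
    (hf : ∀ x, f x ≤ 0) : localE p f ≤ 0 := by
  unfold localE
  nlinarith [mul_nonneg h1 (neg_nonneg.mpr (hf true)),
    mul_nonneg (sub_nonneg.mpr h2) (neg_nonneg.mpr (hf false))]

/-- A temporal selection selecting infinitely often has divergent counting sum. -/
lemma tendsto_sel (S : Situation → Bool) (ϖ : BinPath)
    (h : ∀ N, ∃ n ≥ N, S (pref ϖ n) = true) :
    Tendsto (fun n => ∑ k ∈ Finset.range n, selVal S ϖ k) atTop atTop := by
  have hnn : ∀ k, 0 ≤ selVal S ϖ k := by
    intro k; unfold selVal; split_ifs <;> norm_num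
  have hmono : Monotone (fun n => ∑ k ∈ Finset.range n, selVal S ϖ k) := by
    refine monotone_nat_of_le_succ ?_
    intro n
    rw [Finset.sum_range_succ]
    linarith [hnn n]
  have hub : ∀ m : ℕ, ∃ n, (m : ℝ) ≤ ∑ k ∈ Finset.range n, selVal S ϖ k := by
    intro m
    induction m with
    | zero => exact ⟨0, by simp⟩
    | succ m ih =>
      obtain ⟨n, hn⟩ := ih
      obtain ⟨n', hn', hs⟩ := h n
      refine ⟨n' + 1, ?_⟩
      rw [Finset.sum_range_succ]
      have h1 : selVal S ϖ n' = 1 := by simp [selVal, hs]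
      have h2 := hmono hn'
      simp only at h2
      push_cast
      linarith
  refine tendsto_atTop_atTop_of_monotone hmono ?_
  intro b
  obtain ⟨m, hm⟩ := exists_nat_ge b
  obtain ⟨n, hn⟩ := hub m
  exact ⟨n, hm.trans hn⟩

/-- If the selected positions always have the same outcome, the weighted average is constant. -/
lemma ratio_eventually (S : Situation → Bool) (ϖ : BinPath) (c : ℝ) (b : Bool)
    (hb : ∀ k, S (pref ϖ k) = true → ϖ k = b)
    (ht : Tendsto (fun n => ∑ k ∈ Finset.range n, selVal S ϖ k) atTop atTop) :
    Tendsto (fun n =>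
          (((∑ k ∈ Finset.range n, selVal S ϖ k * (bit (ϖ k) - c)) /
              (∑ k ∈ Finset.range n, selVal S ϖ k) : ℝ) : EReal)) atTop
      (nhds ((bit b - c : ℝ) : EReal)) := by
  have he : ∀ᶠ n in atTop, (((∑ k ∈ Finset.range n, selVal S ϖ k * (bit (ϖ k) - c)) /
              (∑ k ∈ Finset.range n, selVal S ϖ k) : ℝ) : EReal) = ((bit b - c : ℝ) : EReal) := by
    filter_upwards [ht.eventually_gt_atTop 0] with n hn
    congr 1
    rw [div_eq_iff hn.ne', Finset.mul_sum]
    refine Finset.sum_congr rfl ?_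
    intro k _
    by_cases hk : S (pref ϖ k) = true
    · rw [hb k hk]; ring
    · simp [selVal, hk]
  exact tendsto_const_nhds.congr' (he.mono fun n hn => hn.symm)

/-- Eventually the selection process selects nothing. -/
lemma eventually_not_sel {ilo ihi : ℝ} (h0 : 0 < ilo) (h1 : ihi < 1)
    {𝒮 : Set (Situation → Bool)} {ϖ : BinPath}
    (hϖ : SSetRandom 𝒮 (fun _ => ilo) (fun _ => ihi) ϖ)
    (S : Situation → Bool) (hS : S ∈ 𝒮) (b : Bool)
    (hb : ∀ k, S (pref ϖ k) = true → ϖ k = b) :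
    ∃ N, ∀ n ≥ N, S (pref ϖ n) = false := by
  by_contra hcon
  push Not at hcon
  have hinf : ∀ N, ∃ n ≥ N, S (pref ϖ n) = true := by
    intro N
    obtain ⟨n, hn, h⟩ := hcon N
    exact ⟨n, hn, by simpa using h⟩
  have ht := tendsto_sel S ϖ hinf
  obtain ⟨hl, hu⟩ := hϖ S hS ht
  have e1 := (ratio_eventually S ϖ ilo b hb ht).liminf_eq
  have e2 := (ratio_eventually S ϖ ihi b hb ht).limsup_eq
  simp only at hl hu
  rw [e1] at hl
  rw [e2] at hu
  have hl' : (0 : ℝ) ≤ bit b - ilo := by exact_mod_cast hl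
  have hu' : bit b - ihi ≤ (0 : ℝ) := by exact_mod_cast hu
  cases b
  · simp [bit] at hl'; linarith
  · simp [bit] at hu'; linarith

lemma bounded_level (T : Situation → ℝ) (N : ℕ) :
    ∃ R : ℕ, 0 < R ∧ ∀ s : Situation, s.length = N → T s ≤ R := by
  have hfin : (T '' {s : Situation | s.length = N}).Finite := (List.finite_length_eq Bool N).image T
  obtain ⟨B, hB⟩ := hfin.bddAbove
  obtain ⟨m, hm⟩ := exists_nat_ge B
  refine ⟨m + 1, Nat.succ_pos _, ?_⟩
  intro s hs
  have := hB ⟨s, hs, rfl⟩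
  push_cast
  linarith

/-- The process that stays at `1` before level `N` and then follows `T / R`. -/
noncomputable def startAt (T : Situation → ℝ) (N R : ℕ) : Situation → ℝ :=
  fun s => if s.length < N then 1 else T s / R

lemma startAt_lsc {T : Situation → ℝ} (hT : IsLSCProcess T) (N R : ℕ) (hR : 0 < R) :
    IsLSCProcess (startAt T N R) := by
  obtain ⟨c, hc, hmono, hlim⟩ := hT
  have hRq : (0 : ℚ) < R := by exact_mod_cast hR
  refine ⟨fun s n => bif decide (s.length < N) then 1 else c s n / R, ?_, ?_, ?_⟩
  · refine Computable.cond (c := fun z : Situation × ℕ => decide (z.1.length < N))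
      (f := fun _ => (1 : ℚ)) (g := fun z => c z.1 z.2 / R) ?_ (Computable.const _) ?_
    · have hp : PrimrecPred (fun z : Situation × ℕ => z.1.length < N) :=
        Primrec.nat_lt.comp (Primrec.list_length.comp Primrec.fst) (Primrec.const N)
      exact hp.decide.to_comp
    · exact (divConst_computable R hR).comp hc
  · intro s n
    by_cases h : s.length < N
    · simp [h]
    · simp only [h, decide_false, cond_false]
      exact div_le_div_of_nonneg_right (hmono s n) hRq.le
  · intro s
    by_cases h : s.length < N
    · simp [h, startAt]
    · simp only [h, decide_false, cond_false, startAt, if_false]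
      push_cast
      exact (hlim s).div_const _

lemma unbounded_startAt {T : Situation → ℝ} {ω : BinPath} (h : UnboundedOn T ω) (N R : ℕ)
    (hR : 0 < R) : UnboundedOn (startAt T N R) ω := by
  have hRr : (0 : ℝ) < R := by exact_mod_cast hR
  unfold UnboundedOn at *
  rw [EReal.eq_top_iff_forall_lt]
  intro y
  have h1 : (((y + 1) * R : ℝ) : EReal) < limsup (fun n => ((T (pref ω n) : ℝ) : EReal)) atTop := by
    rw [h]; exact EReal.coe_lt_top _
  have h2 := frequently_lt_of_lt_limsup (by isBoundedDefault) h1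
  have h3 : ∃ᶠ n in atTop, ((y + 1 : ℝ) : EReal) ≤ ((startAt T N R (pref ω n) : ℝ) : EReal) := by
    refine (h2.and_eventually (eventually_ge_atTop N)).mono ?_
    rintro n ⟨hn, hN⟩
    have hn' : (y + 1) * R < T (pref ω n) := by exact_mod_cast hn
    have : startAt T N R (pref ω n) = T (pref ω n) / R := by
      simp [startAt, pref_length, not_lt.mpr hN]
    rw [this, EReal.coe_le_coe_iff, le_div_iff₀ hRr]
    exact hn'.le
  have h4 := le_limsup_of_frequently_le h3 (by isBoundedDefault)
  refine lt_of_lt_of_le ?_ h4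
  exact_mod_cast lt_add_one y

/-- main theorem, case R = ML: if `ϖ` is `𝒮`-random for a
stationary interval forecast `I ⊆ (0,1)` with `𝒮 ⊇ 𝒮^{p,q}_{𝓕_ML}` countable,
then a path is ML-random for `φ^ϖ_{p,q}` iff it is ML-random for `[p,q]`. -/
theorem statement_18 (p q : ℝ) (hp0 : 0 ≤ p) (hpq : p < q) (hq1 : q ≤ 1)
    (ilo ihi : ℝ) (h0 : 0 < ilo) (hle : ilo ≤ ihi) (h1 : ihi < 1)
    (𝒮 : Set (Situation → Bool)) (hc : 𝒮.Countable) (hsub : SelSet p q FsetML ⊆ 𝒮)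
    (ϖ : BinPath) (hϖ : SSetRandom 𝒮 (fun _ => ilo) (fun _ => ihi) ϖ)
    (ω : BinPath) :
    MLRandom (tempFS p q ϖ) (tempFS p q ϖ) ω ↔ MLRandom (fun _ => p) (fun _ => q) ω := by
  have hp1 : p ≤ 1 := by linarith
  have hq0 : 0 ≤ q := by linarith
  constructor
  · intro h T hT hTs
    refine h T hT ⟨?_, hTs.2⟩
    intro s
    have hs := (upperE_nonpos_iff _ _ _).mp (hTs.1 s)
    rw [upperE_nonpos_iff]
    simp only [tempFS]
    split_ifs
    · exact ⟨hs.2, hs.2⟩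
    · exact ⟨hs.1, hs.1⟩
  · intro h T hT hTs hunb
    have hTF : T ∈ FsetML := ⟨hT, hTs.2.1, hTs.2.2⟩
    have hloc : ∀ s : Situation, localE (if ϖ s.length then q else p) (diffP T s) ≤ 0 :=
      fun s => ((upperE_nonpos_iff _ _ _).mp (hTs.1 s)).1
    obtain ⟨N₁, hN₁⟩ := eventually_not_sel h0 h1 hϖ (selProc p T)
      (hsub ⟨T, hTF, p, by simp, rfl⟩) true (by
        intro k hk
        simp only [selProc, pref_length, Bool.if_false_right, Bool.and_true,
          decide_eq_true_eq] at hk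
        obtain ⟨t, ht, hpos⟩ := hk
        by_contra hc
        have := hloc t
        rw [ht, if_neg hc] at this
        linarith)
    obtain ⟨N₂, hN₂⟩ := eventually_not_sel h0 h1 hϖ (selProc q T)
      (hsub ⟨T, hTF, q, by simp, rfl⟩) false (by
        intro k hk
        simp only [selProc, pref_length, Bool.if_false_right, Bool.and_true,
          decide_eq_true_eq] at hk
        obtain ⟨t, ht, hpos⟩ := hk
        by_contra hc
        have := hloc t
        rw [ht, if_pos (by simpa using hc)] at this
        linarith)
    have hle_p : ∀ s : Situation, N₁ ≤ s.length → localE p (diffP T s) ≤ 0 := by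
      intro s hs
      by_contra hc
      have h3 := hN₁ _ hs
      simp only [selProc, pref_length, Bool.if_false_right, Bool.and_true,
          decide_eq_false_iff_not] at h3
      exact h3 ⟨s, rfl, not_le.mp hc⟩
    have hle_q : ∀ s : Situation, N₂ ≤ s.length → localE q (diffP T s) ≤ 0 := by
      intro s hs
      by_contra hc
      have h3 := hN₂ _ hs
      simp only [selProc, pref_length, Bool.if_false_right, Bool.and_true,
          decide_eq_false_iff_not] at h3
      exact h3 ⟨s, rfl, not_le.mp hc⟩
    obtain ⟨N, hN⟩ : ∃ N, N = max N₁ N₂ + 1 := ⟨_, rfl⟩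
    obtain ⟨R, hR, hRT⟩ := bounded_level T N
    have hRr : (0 : ℝ) < R := by exact_mod_cast hR
    refine h (startAt T N R) (startAt_lsc hT N R hR) ⟨?_, ?_, ?_⟩ (unbounded_startAt hunb N R hR)
    · intro s
      rw [upperE_nonpos_iff]
      by_cases hs : s.length < N
      · have hd : ∀ x, diffP (startAt T N R) s x ≤ 0 := by
          intro x
          simp only [diffP, startAt, List.length_append, List.length_singleton, hs, if_true]
          split_ifs with h2
          · simp
          · have hl : s.length + 1 = N := by omega
            have := hRT (s ++ [x]) (by simpa using hl)
            have := (div_le_one hRr).mpr this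
            linarith
        exact ⟨localE_nonpos_of hp0 hp1 hd, localE_nonpos_of hq0 hq1 hd⟩
      · have hd : ∀ r, localE r (diffP (startAt T N R) s) = localE r (diffP T s) / R := by
          intro r
          have h2 : ¬ s.length + 1 < N := by omega
          simp only [localE, diffP, startAt, List.length_append, List.length_singleton, hs, h2,
            if_false]
          ring
        rw [hd, hd]
        have a1 : N₁ ≤ s.length := by have := le_max_left N₁ N₂; omega
        have a2 : N₂ ≤ s.length := by have := le_max_right N₁ N₂; omega
        exact ⟨div_nonpos_of_nonpos_of_nonneg (hle_p s a1) hRr.le,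
          div_nonpos_of_nonpos_of_nonneg (hle_q s a2) hRr.le⟩
    · intro s
      simp only [startAt]
      split_ifs
      · norm_num
      · exact div_nonneg (hTs.2.1 s) hRr.le
    · simp [startAt, hN]
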